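/- Let X ⊂ int(𝔸) be an essential annular continuum and let α, γ be hairs of V such that no translate α + k with k ≠ 0 intersects γ. If (γ(1))₁ < min(α)₁ − 1, then max(γ)₁ > max(α)₁ − 1. -/

import Mathlib

open Set Function MeasureTheory Filter Topology

noncomputable section

/-- The vertical fiber `[-1,1]`. -/
abbrev II : Set ℝ := Set.Icc (-1 : ℝ) 1

/-- The universal cover `ℝ × [-1,1]` of the annulus. -/
abbrev Strip : Type := ℝ × II

/-- The compact annulus `(ℝ/ℤ) × [-1,1]`. -/
abbrev Ann : Type := AddCircle (1 : ℝ) × II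

/-- The covering projection `π`. -/
def pr (z : Strip) : Ann := ((z.1 : AddCircle (1 : ℝ)), z.2)

/-- The deck transformation `T^k`. -/
def shiftPt (k : ℤ) (z : Strip) : Strip := (z.1 + k, z.2)

/-- `S + k`, the image of `S` under `T^k`. -/
def shiftSet (k : ℤ) (S : Set Strip) : Set Strip := shiftPt k '' S

/-- `f` is isotopic to the identity. -/
def IsotopicToId (f : Ann → Ann) : Prop :=
  ∃ H : ℝ → Ann → Ann, Continuous (fun p : ℝ × Ann => H p.1 p.2) ∧
    (∀ t : ℝ, Function.Bijective (H t)) ∧ H 0 = id ∧ H 1 = f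

/-- `F` is a lift of `f` commuting with the deck transformation. -/
def IsLift (f : Ann → Ann) (F : Strip → Strip) : Prop :=
  (∀ z, pr (F z) = f (pr z)) ∧ (∀ z, F (shiftPt 1 z) = shiftPt 1 (F z))

/-- `X` is an essential annular continuum with complementary components `Um`, `Up`. -/
structure IsEAC (X Um Up : Set Ann) : Prop where
  compact : IsCompact X
  connected : IsConnected X
  inInterior : ∀ p ∈ X, ((p.2 : ℝ)) ∈ Set.Ioo (-1 : ℝ) 1
  hUm : Um = connectedComponentIn Xᶜ ((0 : AddCircle (1 : ℝ)), ⟨-1, le_rfl, by norm_num⟩)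
  hUp : Up = connectedComponentIn Xᶜ ((0 : AddCircle (1 : ℝ)), ⟨1, by norm_num, le_rfl⟩)
  cover : Xᶜ = Um ∪ Up
  ne : Um ≠ Up

/-- An arc `γ : [0,1] → U ∪ {p}` with `γ([0,1)) ⊂ U` and `γ(1) = p`. -/
def IsArcTo (U : Set Strip) (γ : unitInterval → Strip) (p : Strip) : Prop :=
  Continuous γ ∧ Function.Injective γ ∧ (∀ t, t ≠ 1 → γ t ∈ U) ∧ γ 1 = p

/-- `p` is accessible from `U`. -/
def AccFrom (U : Set Strip) (p : Strip) : Prop := ∃ γ, IsArcTo U γ p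

/-- The order `≺` on accessible points, with access arcs starting on `ℝ × {b}`. -/
def PrecB (b : ℝ) (U : Set Strip) (x x' : Strip) : Prop :=
  ∃ γ γ' : unitInterval → Strip,
    IsArcTo U γ x ∧ IsArcTo U γ' x' ∧
    ((γ 0).2 : ℝ) = b ∧ ((γ' 0).2 : ℝ) = b ∧
    Disjoint (range γ) (range γ') ∧ (γ 0).1 < (γ' 0).1

/-- `k = k(x,y)` is the unique integer with `T^k(y) ⪯ x ≺ T^{k+1}(y)`. -/
def AccIdxB (b : ℝ) (U : Set Strip) (x y : Strip) (k : ℤ) : Prop :=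
  (shiftPt k y = x ∨ PrecB b U (shiftPt k y) x) ∧ PrecB b U x (shiftPt (k + 1) y)

/-- `ρ` is the prime end rotation number of the lift `F` as seen from `U`
(access arcs starting at height `b`): `k(Fⁿ(x), y)/n → ρ` for all accessible `x, y`. -/
def PrimeEndRotB (b : ℝ) (U Xt : Set Strip) (F : Strip → Strip) (ρ : ℝ) : Prop :=
  ∀ x ∈ Xt, ∀ y ∈ Xt, AccFrom U x → AccFrom U y →
    ∀ k : ℕ → ℤ, (∀ n : ℕ, AccIdxB b U (F^[n] x) y (k n)) →
      Tendsto (fun n : ℕ => (k n : ℝ) / (n : ℝ)) atTop (𝓝 ρ)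

/-- The measure-theoretic rotation set `ρ_mes(g̃, X)`, where `φ` is the displacement
function of the lift `g̃` (pushed down to the annulus). -/
def rotMes (g : Ann → Ann) (φ : Ann → ℝ) (X : Set Ann) : Set ℝ :=
  {r | ∃ μ : Measure Ann, IsProbabilityMeasure μ ∧ Measure.map g μ = μ ∧
    μ Xᶜ = 0 ∧ ∫ a, φ a ∂μ = r}

/-- A point in the interior of the top boundary segment `(0,1) × {1}`. -/
def topSeg : Strip := ((1 : ℝ) / 2, ⟨1, by norm_num, le_rfl⟩)

/-- `β' = β ∖ {x₀} = {0} × (η, 1]`. -/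
def betaP (η : ℝ) : Set Strip := {z : Strip | z.1 = 0 ∧ η < (z.2 : ℝ)}

/-- `η = max{y : (0,y) ∈ X̃}`. -/
def etaSpec (Xt : Set Strip) (η : ℝ) : Prop :=
  IsGreatest {y : ℝ | ∃ z ∈ Xt, z.1 = 0 ∧ (z.2 : ℝ) = y} η

/-- The fundamental region `V`: the closure, relative to `Ũ₊`, of the connected
component of `Ũ₊ ∖ (β' ∪ (β' + 1))` containing the segment `(0,1) × {1}`. -/
def Vset (Utp : Set Strip) (η : ℝ) : Set Strip :=
  Utp ∩ closure (connectedComponentIn (Utp \ (betaP η ∪ shiftSet 1 (betaP η))) topSeg)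

/-- A hair of `W`: an arc in `W` starting on `ℝ × {1}`. -/
def IsHair (W : Set Strip) (γ : unitInterval → Strip) : Prop :=
  Continuous γ ∧ Function.Injective γ ∧ ((γ 0).2 : ℝ) = 1 ∧ ∀ t, γ t ∈ W

/-- `(γ)₁`, the projection of the image of `γ` to the first coordinate. -/
def proj1 (γ : unitInterval → Strip) : Set ℝ := range fun t => (γ t).1

/-- `(V + k)⁻ = ⋃_{j ≤ k} (V + j)`. -/
def VMinus (k : ℤ) (V : Set Strip) : Set Strip := ⋃ j ∈ Iic k, shiftSet j V

/-- `(V + k)⁺ = ⋃_{j ≥ k} (V + j)`. -/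
def VPlus (k : ℤ) (V : Set Strip) : Set Strip := ⋃ j ∈ Ici k, shiftSet j V

/-- A crosscut of `Ũ₊`: an arc with endpoints on `X̃` and interior in `Ũ₊`. -/
def IsCrosscut (Utp Xt : Set Strip) (c : unitInterval → Strip) : Prop :=
  Continuous c ∧ Function.Injective c ∧ c 0 ∈ Xt ∧ c 1 ∈ Xt ∧
    ∀ t, t ≠ 0 → t ≠ 1 → c t ∈ Utp

/-- `F^n` for `n : ℤ`. -/
def iterZ (F : Strip ≃ₜ Strip) (n : ℤ) : Strip → Strip := fun z => (F.toEquiv ^ n) z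

end

section HairHelpers

open unitInterval

lemma stay_lt {θ : ℝ → ℝ} (hθ : Continuous θ) {c a : ℝ} (hne : ∀ t, θ t ≠ c) (ha : θ a < c)
    (b : ℝ) : θ b < c := by
  by_contra hb
  push Not at hb
  have := mem_range_of_exists_le_of_exists_ge hθ ⟨a, ha.le⟩ ⟨b, hb⟩
  obtain ⟨t, ht⟩ := this
  exact hne t ht

lemma stay_gt {θ : ℝ → ℝ} (hθ : Continuous θ) {c a : ℝ} (hne : ∀ t, θ t ≠ c) (ha : c < θ a)
    (b : ℝ) : c < θ b := by
  by_contra hb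
  push Not at hb
  obtain ⟨t, ht⟩ := mem_range_of_exists_le_of_exists_ge hθ ⟨b, hb⟩ ⟨a, ha.le⟩
  exact hne t ht

/-- A winding number obstruction on the square. -/
lemma no_wind (F : I → I → ℂ) (hF : Continuous (fun p : I × I => F p.1 p.2))
    (h0 : ∀ s t, F s t ≠ 0) (hre : 0 < (F 0 0).re) (him : (F 0 0).im = 0)
    (e1 : ∀ t, (F 0 t).im ≤ 0) (hc : (F 0 1).re < 0)
    (e2 : ∀ s, (F s 1).re ≤ 0 ∨ 0 ≤ (F s 1).im)
    (e3 : ∀ t, (F 1 t).re ≤ 0 ∨ 0 ≤ (F 1 t).im)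
    (e4 : ∀ s, (F s 0).re ≤ 0 ∨ 0 ≤ (F s 0).im) : False := by
  let P : ℝ → I := projIcc 0 1 zero_le_one
  have hP : Continuous P := continuous_projIcc
  have P0 : P 0 = 0 := projIcc_left ..
  have P1 : P 1 = 1 := projIcc_right ..
  let G : C(ℝ × ℝ, ℂ) := ⟨fun p => F (P p.1) (P p.2),
    hF.comp (f := fun p : ℝ × ℝ => (P p.1, P p.2)) (by fun_prop)⟩
  have hG : ∀ s t, G (s, t) = F (P s) (P t) := fun s t => rfl
  obtain ⟨L, ⟨hL0, hL⟩, -⟩ := Complex.isCoveringMapOn_exp.existsUnique_continuousMap_lifts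
    G (a₀ := (0, 0)) (e₀ := Complex.log (F 0 0))
    (by rw [Complex.exp_log (h0 _ _), hG, P0]) (fun p => h0 _ _)
  let θ : ℝ × ℝ → ℝ := fun p => (L p).im
  have hθ : Continuous θ := by fun_prop
  have hE : ∀ s t, Complex.exp (L (s, t)) = F (P s) (P t) := fun s t => congrFun hL (s, t)
  have hcos : ∀ s t, (F (P s) (P t)).re = Real.exp (L (s, t)).re * Real.cos (θ (s, t)) := by
    intro s t; rw [← hE, Complex.exp_re]
  have hsin : ∀ s t, (F (P s) (P t)).im = Real.exp (L (s, t)).re * Real.sin (θ (s, t)) := by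
    intro s t; rw [← hE, Complex.exp_im]
  have hθ0 : θ (0, 0) = 0 := by
    change (L (0, 0)).im = 0
    rw [hL0, Complex.log_im, Complex.arg_eq_zero_iff]
    exact ⟨hre.le, him⟩
  have hpi := Real.pi_pos
  have hE1 : θ (0, 1) < -(Real.pi / 4) := by
    have hlt := stay_lt (θ := fun t => θ (0, t)) (c := Real.pi / 2) (a := 0) (by fun_prop)
      (fun t ht => by
        have h1 := hsin 0 t
        have h2 := e1 (P t)
        rw [ht, Real.sin_pi_div_two, P0] at h1
        have := Real.exp_pos (L (0, t)).re
        linarith) (by simp only [hθ0]; linarith) 1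
    have h1 := hcos 0 1
    rw [P0, P1] at h1
    by_contra hcon
    push Not at hcon
    have : 0 ≤ Real.cos (θ (0, 1)) :=
      Real.cos_nonneg_of_mem_Icc ⟨by linarith, hlt.le⟩
    have := mul_nonneg (Real.exp_pos (L (0, 1)).re).le this
    linarith
  have key : ∀ s t, ((F (P s) (P t)).re ≤ 0 ∨ 0 ≤ (F (P s) (P t)).im) →
      θ (s, t) ≠ -(Real.pi / 4) := by
    intro s t h hh
    have h1 := hcos s t
    have h2 := hsin s t
    rw [hh] at h1 h2
    rw [Real.cos_neg, Real.cos_pi_div_four] at h1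
    rw [Real.sin_neg, Real.sin_pi_div_four] at h2
    have hp := Real.exp_pos (L (s, t)).re
    have hs : 0 < Real.sqrt 2 / 2 := by positivity
    have := mul_pos hp hs
    rcases h with h | h <;> nlinarith
  have hE2 : θ (1, 1) < -(Real.pi / 4) :=
    stay_lt (θ := fun s => θ (s, 1)) (a := 0) (by fun_prop)
      (fun s => key s 1 (by rw [P1]; exact e2 _)) hE1 1
  have hE3 : θ (1, 0) < -(Real.pi / 4) :=
    stay_lt (θ := fun t => θ (1, t)) (a := 1) (by fun_prop)
      (fun t => key 1 t (by rw [P1]; exact e3 _)) hE2 0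
  have hE4 : θ (0, 0) < -(Real.pi / 4) :=
    stay_lt (θ := fun s => θ (s, 0)) (a := 1) (by fun_prop)
      (fun s => key s 0 (by rw [P0]; exact e4 _)) hE3 0
  linarith

/-- Difference of two points of the strip, as a complex number. -/
def diffC (z w : Strip) : ℂ := ⟨z.1 - w.1, (z.2 : ℝ) - w.2⟩

lemma diffC_cont {A : Type*} [TopologicalSpace A] {f g : A → Strip} (hf : Continuous f)
    (hg : Continuous g) : Continuous (fun a => diffC (f a) (g a)) := by
  have : (fun a => diffC (f a) (g a)) =
      fun a => (((f a).1 - (g a).1 : ℝ) : ℂ) + ((((f a).2 : ℝ) - (g a).2 : ℝ) : ℂ) * Complex.I := by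
    funext a
    apply Complex.ext <;> simp [diffC]
  rw [this]
  fun_prop

lemma diffC_ne {z w : Strip} (h : z ≠ w) : diffC z w ≠ 0 := by
  intro h'
  apply h
  have h1 := congrArg Complex.re h'
  have h2 := congrArg Complex.im h'
  simp only [diffC, Complex.zero_re, Complex.zero_im] at h1 h2
  exact Prod.ext (by linarith) (Subtype.ext (by linarith))

lemma snd_le (z : Strip) : (z.2 : ℝ) ≤ 1 := z.2.2.2
lemma le_snd (z : Strip) : (-1 : ℝ) ≤ (z.2 : ℝ) := z.2.2.1

lemma cross_top (sg τ : I → Strip) (hsg : Continuous sg) (hτ : Continuous τ)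
    (hd : ∀ s t, sg t ≠ τ s) (h0 : ((sg 0).2 : ℝ) = 1) (h1 : ((sg 1).2 : ℝ) = 1)
    (h2 : ((τ 0).2 : ℝ) = 1) (h3 : ((τ 1).2 : ℝ) = -1)
    (ha : (sg 1).1 < (τ 0).1) (hb : (τ 0).1 < (sg 0).1) : False := by
  apply no_wind (fun s t => diffC (sg t) (τ s))
    (diffC_cont (hsg.comp continuous_snd) (hτ.comp continuous_fst))
    (fun s t => diffC_ne (hd s t))
  · simp only [diffC]; linarith
  · simp only [diffC]; linarith
  · intro t; simp only [diffC]; linarith [snd_le (sg t)]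
  · simp only [diffC]; linarith
  · intro s; right; simp only [diffC]; linarith [snd_le (τ s)]
  · intro s; right; simp only [diffC]; linarith [le_snd (sg s)]
  · intro s; right; simp only [diffC]; linarith [snd_le (τ s)]

instance locIcc : LocallyPathConnectedSpace II :=
  (isQuotientMap_projIcc (a := (-1 : ℝ)) (b := 1) (h := by norm_num)).locallyPathConnectedSpace

instance locCirc : LocallyPathConnectedSpace (AddCircle (1 : ℝ)) :=
  (QuotientAddGroup.isQuotientMap_mk (N := AddSubgroup.zmultiples (1 : ℝ))).locallyPathConnectedSpace

lemma pr_cont : Continuous pr := by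
  unfold pr
  exact ((AddCircle.continuous_mk' 1).comp continuous_fst).prodMk continuous_snd

lemma eac_compl {X Um Up : Set Ann} (hX : IsEAC X Um Up) :
    IsOpen Up ∧ IsPreconnected Upᶜ ∧ X ⊆ Upᶜ ∧ Um ⊆ Upᶜ := by
  have hXo : IsOpen Xᶜ := hX.compact.isClosed.isOpen_compl
  have hUo : IsOpen Up := by rw [hX.hUp]; exact hXo.connectedComponentIn
  have hUmo : IsOpen Um := by rw [hX.hUm]; exact hXo.connectedComponentIn
  have hdis : Disjoint Um Up := by
    by_contra h
    rw [Set.not_disjoint_iff] at h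
    obtain ⟨x, hx1, hx2⟩ := h
    apply hX.ne
    rw [hX.hUm] at hx1 ⊢
    rw [hX.hUp] at hx2 ⊢
    rw [connectedComponentIn_eq hx1, connectedComponentIn_eq hx2]
  have hXU : X ⊆ Upᶜ := by
    intro x hx hU
    have : x ∈ Xᶜ := by rw [hX.cover]; exact Or.inr hU
    exact this hx
  have hUmU : Um ⊆ Upᶜ := hdis.subset_compl_right
  have heq : Upᶜ = X ∪ Um := by
    apply Subset.antisymm
    · intro x hx
      by_cases h : x ∈ X
      · exact Or.inl h
      · have : x ∈ Xᶜ := h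
        rw [hX.cover] at this
        exact Or.inr (this.resolve_right hx)
    · exact union_subset hXU hUmU
  have hb : ((0 : AddCircle (1 : ℝ)), (⟨-1, le_rfl, by norm_num⟩ : II)) ∈ Um := by
    rw [hX.hUm]
    apply mem_connectedComponentIn
    intro h
    have := (hX.inInterior _ h).1
    simp at this
  have hUmc : IsPreconnected Um := by rw [hX.hUm]; exact isPreconnected_connectedComponentIn
  refine ⟨hUo, ?_, hXU, hUmU⟩
  have hne : (closure Um ∩ X).Nonempty := by
    by_contra hemp
    rw [Set.not_nonempty_iff_eq_empty] at hemp
    have hsub : closure Um ⊆ Xᶜ := by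
      intro x hx hx'
      have : x ∈ closure Um ∩ X := ⟨hx, hx'⟩
      rw [hemp] at this
      exact this
    have hsub2 : closure Um ⊆ Um := by
      have := hUmc.closure.subset_connectedComponentIn (subset_closure hb) hsub
      rwa [← hX.hUm] at this
    have hcl : IsClosed Um := closure_subset_iff_isClosed.mp hsub2
    have : PreconnectedSpace II := isPreconnected_iff_preconnectedSpace.mp isPreconnected_Icc
    have huniv := IsClopen.eq_univ ⟨hcl, hUmo⟩ ⟨_, hb⟩
    obtain ⟨x, hx⟩ := hX.connected.nonempty
    have : x ∈ Um := by rw [huniv]; trivial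
    exact hsub (subset_closure this) hx
  obtain ⟨x, hx1, hx2⟩ := hne
  rw [heq]
  have h1 : IsPreconnected (insert x Um) :=
    hUmc.subset_closure (subset_insert _ _) (insert_subset hx1 subset_closure)
  have h2 := hX.connected.isPreconnected.union x hx2 (mem_insert x Um) h1
  have : X ∪ insert x Um = X ∪ Um := by
    ext y
    simp only [mem_union, mem_insert_iff]
    constructor
    · rintro (h | rfl | h)
      · exact Or.inl h
      · exact Or.inl hx2
      · exact Or.inr h
    · rintro (h | h)
      · exact Or.inl h
      · exact Or.inr (Or.inr h)
  rwa [this] at h2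

lemma pr_shift (k : ℤ) (x : ℝ) (y : II) : pr (x + k, y) = pr (x, y) := by
  unfold pr
  have : ((k : ℝ) : AddCircle (1 : ℝ)) = 0 := by
    rw [AddCircle.coe_eq_zero_iff]
    exact ⟨k, by simp⟩
  simp [this]

/-- The vertical segment over the integer `k`, above `X`, separates the lifted upper domain. -/
lemma sep {X Um Up : Set Ann} (hX : IsEAC X Um Up) {η : ℝ} (hη : etaSpec (pr ⁻¹' X) η)
    (k : ℤ) (p a : Strip) (hp : (p.2 : ℝ) = 1) (ha : (a.2 : ℝ) = 1) (hak : a.1 < k)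
    (hkp : k < p.1) :
    ¬ JoinedIn (pr ⁻¹' Up \ {z : Strip | z.1 = k ∧ η < (z.2 : ℝ)}) p a := by
  rintro ⟨sg, hsg⟩
  obtain ⟨hUo, hK, hXU, hUmU⟩ := eac_compl hX
  obtain ⟨⟨z0, hz0X, hz01, hz02⟩, -⟩ := hη
  -- the base point over k
  have hx0 : pr ((k : ℝ), z0.2) ∈ X := by
    have h := pr_shift k 0 z0.2
    rw [zero_add] at h
    rw [h]
    have : ((0 : ℝ), z0.2) = z0 := by rw [← hz01]
    rw [this]
    exact hz0X
  have hb : ((0 : AddCircle (1 : ℝ)), (⟨-1, le_rfl, by norm_num⟩ : II)) ∈ Upᶜ := by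
    apply hUmU
    rw [hX.hUm]
    apply mem_connectedComponentIn
    intro h
    have := (hX.inInterior _ h).1
    simp at this
  set O : Set Ann := (pr '' range sg)ᶜ with hO
  have hOo : IsOpen O :=
    ((isCompact_range sg.continuous).image pr_cont).isClosed.isOpen_compl
  have hKO : Upᶜ ⊆ O := by
    rintro x hx ⟨w, ⟨t, rfl⟩, rfl⟩
    exact hx (hsg t).1
  have hx0K := hXU hx0
  set N := connectedComponentIn O (pr ((k : ℝ), z0.2)) with hN
  have hNO : N ⊆ O := connectedComponentIn_subset _ _
  have hNo : IsOpen N := hOo.connectedComponentIn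
  have hKN : Upᶜ ⊆ N := hK.subset_connectedComponentIn hx0K hKO
  have hNc : IsConnected N := isConnected_connectedComponentIn_iff.mpr (hKO hx0K)
  have hNp : IsPathConnected N := hNo.isConnected_iff_isPathConnected.mp hNc
  obtain ⟨δ, hδ⟩ := hNp.joinedIn _ (hKN hx0K) _ (hKN hb)
  obtain ⟨Γ, hΓ, hΓ0⟩ := (AddCircle.isCoveringMap_coe (1 : ℝ)).exists_path_lifts
    (γ := ⟨fun t => (δ t).1, by fun_prop⟩) (e := (k : ℝ)) (congrArg Prod.fst δ.source)
  have hΓ' : ∀ t, ((Γ t : ℝ) : AddCircle (1 : ℝ)) = (δ t).1 := fun t => congrFun hΓ t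
  have hJ1 : JoinedIn (range sg)ᶜ ((k : ℝ), z0.2) (Γ 1, ⟨-1, le_rfl, by norm_num⟩) := by
    refine ⟨⟨⟨fun t => (Γ t, (δ t).2), by fun_prop⟩, ?_, ?_⟩, ?_⟩
    · exact Prod.ext hΓ0 (congrArg (fun q : Ann => q.2) δ.source)
    · simp
    · rintro t ht
      have h1 : pr (Γ t, (δ t).2) = δ t := by
        unfold pr
        exact Prod.ext (hΓ' t) rfl
      have h2 := hNO (hδ t)
      rw [← h1] at h2
      exact h2 ⟨_, ht, rfl⟩
  have hη1 : η ≤ 1 := by rw [← hz02]; exact z0.2.2.2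
  have hJ2 : JoinedIn (range sg)ᶜ ((k : ℝ), ⟨1, by norm_num, le_rfl⟩) ((k : ℝ), z0.2) := by
    have hm : (-1 : ℝ) ≤ 1 := by norm_num
    let v : ℝ → Strip := fun y => ((k : ℝ), projIcc (-1) 1 hm y)
    have hv : Continuous v := by
      exact continuous_const.prodMk continuous_projIcc
    have hpc : IsPathConnected (v '' Icc η 1) :=
      ((convex_Icc η 1).isPathConnected (nonempty_Icc.mpr hη1)).image hv
    refine (hpc.joinedIn _ ⟨1, ⟨hη1, le_rfl⟩, ?_⟩ _ ⟨η, ⟨le_rfl, hη1⟩, ?_⟩).mono ?_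
    · simp only [v]; rw [projIcc_right]
    · simp only [v]; rw [← hz02, projIcc_val]
    · rintro _ ⟨y, ⟨hy1, hy2⟩, rfl⟩ ⟨t, ht⟩
      have hmem := hsg t
      rw [ht] at hmem
      have hy0 : (-1 : ℝ) ≤ y := by rw [← hz02] at hy1; exact z0.2.2.1.trans hy1
      have hvy : v y = ((k : ℝ), ⟨y, hy0, hy2⟩) := by
        simp only [v]; rw [projIcc_of_mem hm ⟨hy0, hy2⟩]
      rw [hvy] at hmem
      rcases hy1.eq_or_lt with h | h
      · have : (⟨y, hy0, hy2⟩ : II) = z0.2 := Subtype.ext (by simp [hz02, h])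
        rw [this] at hmem
        exact hXU hx0 hmem.1
      · exact hmem.2 ⟨rfl, h⟩
  obtain ⟨τ, hτ⟩ := hJ2.trans hJ1
  refine cross_top sg τ sg.continuous τ.continuous ?_ ?_ ?_ ?_ ?_ ?_ ?_
  · intro s t h
    exact hτ s ⟨t, h⟩
  · simpa using hp
  · simpa using ha
  · simp
  · simp
  · simpa using hak
  · simpa using hkp

lemma V_top {X Um Up : Set Ann} (hX : IsEAC X Um Up) {η : ℝ} (hη : etaSpec (pr ⁻¹' X) η)
    {z : Strip} (hz : z ∈ Vset (pr ⁻¹' Up) η) (hz1 : (z.2 : ℝ) = 1) : 0 ≤ z.1 ∧ z.1 ≤ 1 := by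
  obtain ⟨hUo, hK, hXU, hUmU⟩ := eac_compl hX
  obtain ⟨hzU, hzc⟩ := hz
  have hshift : shiftSet 1 (betaP η) = {z : Strip | z.1 = 1 ∧ η < (z.2 : ℝ)} := by
    ext w
    constructor
    · rintro ⟨u, ⟨h1, h2⟩, rfl⟩
      exact ⟨by simp [shiftPt, h1], h2⟩
    · rintro ⟨h1, h2⟩
      refine ⟨(0, w.2), ⟨rfl, h2⟩, ?_⟩
      apply Prod.ext
      · simp [shiftPt, h1]
      · rfl
  rw [hshift] at hzc
  set S := pr ⁻¹' Up \ (betaP η ∪ {z : Strip | z.1 = 1 ∧ η < (z.2 : ℝ)}) with hS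
  have hUto : IsOpen (pr ⁻¹' Up) := hUo.preimage pr_cont
  have hSeq : S = pr ⁻¹' Up ∩ ({z : Strip | z.1 = 0 ∧ η ≤ (z.2 : ℝ)} ∪
      {z : Strip | z.1 = 1 ∧ η ≤ (z.2 : ℝ)})ᶜ := by
    obtain ⟨⟨z0, hz0X, hz01, hz02⟩, -⟩ := hη
    ext w
    constructor
    · rintro ⟨hw, hn⟩
      refine ⟨hw, ?_⟩
      rintro (⟨h1, h2⟩ | ⟨h1, h2⟩)
      · rcases h2.eq_or_lt with h | h
        · have : w = z0 := Prod.ext (by rw [h1, hz01]) (Subtype.ext (by rw [← h, hz02]))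
          subst this
          exact hXU hz0X hw
        · exact hn (Or.inl ⟨h1, h⟩)
      · rcases h2.eq_or_lt with h | h
        · have : w = (z0.1 + (1 : ℤ), z0.2) :=
            Prod.ext (by simp [h1, hz01]) (Subtype.ext (by rw [← h, hz02]))
          have hw' : pr w ∈ Up := hw
          rw [this, pr_shift] at hw'
          exact hXU hz0X hw'
        · exact hn (Or.inr ⟨h1, h⟩)
    · rintro ⟨hw, hn⟩
      refine ⟨hw, ?_⟩
      rintro (⟨h1, h2⟩ | ⟨h1, h2⟩)
      · exact hn (Or.inl ⟨h1, h2.le⟩)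
      · exact hn (Or.inr ⟨h1, h2.le⟩)
  have hSo : IsOpen S := by
    rw [hSeq]
    refine hUto.inter (IsClosed.isOpen_compl (self := IsClosed.union ?_ ?_))
    · exact (isClosed_eq continuous_fst continuous_const).inter
        (isClosed_le continuous_const (continuous_subtype_val.comp continuous_snd))
    · exact (isClosed_eq continuous_fst continuous_const).inter
        (isClosed_le continuous_const (continuous_subtype_val.comp continuous_snd))
  have hjoin : z ∈ S → JoinedIn S topSeg z := by
    intro hzS
    set C := connectedComponentIn S topSeg with hC
    obtain ⟨N, ⟨hNo, hzN, hNp⟩, hNS⟩ :=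
      (isOpen_isPathConnected_basis z).mem_iff.mp (hSo.mem_nhds hzS)
    obtain ⟨w, hwN, hwC⟩ := mem_closure_iff.mp hzc N hNo hzN
    have htop : topSeg ∈ S := connectedComponentIn_nonempty_iff.mp ⟨w, hwC⟩
    have hCo : IsOpen C := hSo.connectedComponentIn
    have hCp : IsPathConnected C :=
      hCo.isConnected_iff_isPathConnected.mp (isConnected_connectedComponentIn_iff.mpr htop)
    exact ((hCp.joinedIn _ (mem_connectedComponentIn htop) _ hwC).mono
      (connectedComponentIn_subset _ _)).trans ((hNp.joinedIn _ hwN _ hzN).mono hNS)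
  constructor
  · by_contra hlt
    push Not at hlt
    have hzS : z ∈ S := ⟨hzU, by
      rintro (⟨h1, h2⟩ | ⟨h1, h2⟩)
      · linarith
      · linarith⟩
    refine sep hX hη 0 topSeg z rfl hz1 (by simpa using hlt) (by norm_num [topSeg])
      ((hjoin hzS).mono ?_)
    rintro w ⟨hw, hn⟩
    refine ⟨hw, fun h => hn (Or.inl ⟨?_, h.2⟩)⟩
    have := h.1
    simpa using this
  · by_contra hlt
    push Not at hlt
    have hzS : z ∈ S := ⟨hzU, by
      rintro (⟨h1, h2⟩ | ⟨h1, h2⟩)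
      · linarith
      · linarith⟩
    refine sep hX hη 1 z topSeg hz1 rfl (by norm_num [topSeg]) (by simpa using hlt)
      ((hjoin hzS).symm.mono ?_)
    rintro w ⟨hw, hn⟩
    refine ⟨hw, fun h => hn (Or.inr ⟨?_, h.2⟩)⟩
    have := h.1
    simpa using this

end HairHelpers

/-- fact `⋆⋆`: for hairs `α, γ` of `V` with `γ` disjoint from all nontrivial
translates of `α`: if `(γ(1))₁ < min(α)₁ − 1` then `max(γ)₁ > max(α)₁ − 1`. -/
theorem hair_star_star
    (X Um Up : Set Ann) (hX : IsEAC X Um Up)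
    (η : ℝ) (hη : etaSpec (pr ⁻¹' X) η)
    (α γ : unitInterval → Strip)
    (hα : IsHair (Vset (pr ⁻¹' Up) η) α) (hγ : IsHair (Vset (pr ⁻¹' Up) η) γ)
    (hdisj : ∀ k : ℤ, k ≠ 0 → Disjoint (range fun t => shiftPt k (α t)) (range γ))
    (h1 : (γ 1).1 < sInf (proj1 α) - 1) :
    sSup (proj1 γ) > sSup (proj1 α) - 1 := by
  by_contra hcon
  push Not at hcon
  obtain ⟨hαc, -, hα0, hαV⟩ := hα
  obtain ⟨hγc, -, hγ0, hγV⟩ := hγ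
  have hα0' := V_top hX hη (hαV 0) hα0
  have hγ0' := V_top hX hη (hγV 0) hγ0
  have hcα : IsCompact (proj1 α) := isCompact_range (continuous_fst.comp hαc)
  have hcγ : IsCompact (proj1 γ) := isCompact_range (continuous_fst.comp hγc)
  obtain ⟨T, hT⟩ := hcα.sSup_mem (range_nonempty _)
  have hinf : ∀ t, sInf (proj1 α) ≤ (α t).1 := fun t => csInf_le hcα.bddBelow ⟨t, rfl⟩
  have hsup : ∀ t, (γ t).1 ≤ sSup (proj1 γ) := fun t => le_csSup hcγ.bddAbove ⟨t, rfl⟩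
  have hne : ∀ s t, γ t ≠ shiftPt (-1) (α s) := fun s t h =>
    Set.disjoint_left.mp (hdisj (-1) (by norm_num)) ⟨s, rfl⟩ ⟨t, h⟩
  have h00 : (α 0).1 - 1 < (γ 0).1 := by
    rcases (show (α 0).1 - 1 ≤ (γ 0).1 by linarith [hα0'.2, hγ0'.1]).eq_or_lt with h | h
    · exfalso
      apply hne 0 0
      refine Prod.ext ?_ (Subtype.ext ?_)
      · simp [shiftPt, ← h]; ring
      · simp [shiftPt, hα0, hγ0]
    · exact h
  have hsc : Continuous (fun z : Strip => shiftPt (-1) z) := by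
    unfold shiftPt
    fun_prop
  apply no_wind (fun s t => diffC (γ t) (shiftPt (-1) (α (s * T))))
    (diffC_cont (hγc.comp continuous_snd)
      (hsc.comp (hαc.comp (by fun_prop : Continuous fun p : unitInterval × unitInterval => p.1 * T))))
    (fun s t => diffC_ne (hne _ _))
  · simp only [diffC, shiftPt, zero_mul]; push_cast; linarith
  · simp only [diffC, shiftPt, zero_mul]; linarith
  · intro t; simp only [diffC, shiftPt, zero_mul]; linarith [snd_le (γ t)]
  · simp only [diffC, shiftPt, zero_mul]; push_cast; linarith [hinf 0]
  · intro s; left; simp only [diffC, shiftPt]; push_cast; linarith [hinf (s * T)]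
  · intro t; left; simp only [diffC, shiftPt, one_mul]; push_cast
    simp only at hT
    linarith [hsup t]
  · intro s; right; simp only [diffC, shiftPt]; linarith [snd_le (α (s * T))]
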